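/- arXiv:1602.01159 — 5 statements merged into one kernel-verified Lean document; each statement's English description precedes it below -/
import Mathlib

section
/- For the Virasoro Lie conformal algebra Vir, the generalized conformal derivation algebra equals the conformal quasiderivation algebra, and explicitly GDer(Vir) = QDer(Vir) = { D ∈ gc(Vir) : D_λ(L) = (a₀(λ) + a₁(λ)∂)L for some polynomials a₀(λ), a₁(λ) ∈ ℂ[λ] }. -/
open scoped BigOperators

universe u

/-- The data of a Lie conformal algebra over `ℂ`: a `ℂ[∂]`-module `R` (the `ℂ`-module
structure together with the operator `∂ = d`) and the family of coefficients of the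
`λ`-bracket, so that `[a_λ b] = ∑ λ^n • coeff n a b` (a polynomial in `λ` by `locality`). -/
structure LieConformalData (R : Type u) [AddCommGroup R] [Module ℂ R] where
  d : R →ₗ[ℂ] R
  coeff : ℕ → R →ₗ[ℂ] R →ₗ[ℂ] R
  locality : ∀ a b : R, ∃ N : ℕ, ∀ n : ℕ, N ≤ n → coeff n a b = 0

/-- The `λ`-bracket evaluated at a point `lam : ℂ`.  Since `ℂ` is infinite, identities
between the (polynomial) evaluation maps are equivalent to the corresponding formal
polynomial identities in the variable `λ`. -/
noncomputable def LieConformalData.brk {R : Type u} [AddCommGroup R] [Module ℂ R]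
    (L : LieConformalData R) (lam : ℂ) (a b : R) : R :=
  ∑ᶠ n : ℕ, lam ^ n • L.coeff n a b

/-- A Lie conformal algebra over `ℂ`: conformal sesquilinearity, skew-symmetry
`[a_λ b] = -[b_{-λ-∂} a]` and the Jacobi identity
`[a_λ [b_μ c]] = [[a_λ b]_{λ+μ} c] + [b_μ [a_λ c]]`. -/
structure LieConformalAlgebra (R : Type u) [AddCommGroup R] [Module ℂ R]
    extends LieConformalData R where
  sesq_left : ∀ (lam : ℂ) (a b : R),
    toLieConformalData.brk lam (d a) b = -(lam • toLieConformalData.brk lam a b)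
  sesq_right : ∀ (lam : ℂ) (a b : R),
    toLieConformalData.brk lam a (d b)
      = d (toLieConformalData.brk lam a b) + lam • toLieConformalData.brk lam a b
  skew : ∀ (lam : ℂ) (a b : R),
    toLieConformalData.brk lam a b
      = -∑ᶠ n : ℕ, ((((-lam) • (LinearMap.id : R →ₗ[ℂ] R)) - d) ^ n) (coeff n b a)
  jacobi : ∀ (lam mu : ℂ) (a b c : R),
    toLieConformalData.brk lam a (toLieConformalData.brk mu b c)
      = (∑ᶠ n : ℕ, lam ^ n • toLieConformalData.brk (lam + mu) (coeff n a b) c)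
        + toLieConformalData.brk mu b (toLieConformalData.brk lam a c)

section

variable {R : Type u} [AddCommGroup R] [Module ℂ R]

/-- A conformal linear map from `R` to `R` (an element of the general Lie conformal
algebra `gc(R)`), given by its coefficients: `D_λ(a) = ∑ λ^n • coeff n a`, satisfying
`D_λ(∂ a) = (∂ + λ) D_λ(a)`. -/
structure CLin (L : LieConformalAlgebra R) where
  coeff : ℕ → R →ₗ[ℂ] R
  locality : ∀ a : R, ∃ N : ℕ, ∀ n : ℕ, N ≤ n → coeff n a = 0
  conf : ∀ (lam : ℂ) (a : R),
    (∑ᶠ n : ℕ, lam ^ n • coeff n (L.d a))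
      = L.d (∑ᶠ n : ℕ, lam ^ n • coeff n a) + lam • ∑ᶠ n : ℕ, lam ^ n • coeff n a

variable {L : LieConformalAlgebra R}

/-- `D.app lam a` is `D_λ(a)` evaluated at `λ = lam`. -/
noncomputable def CLin.app (D : CLin L) (lam : ℂ) (a : R) : R :=
  ∑ᶠ n : ℕ, lam ^ n • D.coeff n a

/-- Conformal derivations: `D_λ([a_μ b]) = [(D_λ a)_{λ+μ} b] + [a_μ (D_λ b)]`. -/
def IsCDer (D : CLin L) : Prop :=
  ∀ (lam mu : ℂ) (a b : R),
    D.app lam (L.brk mu a b)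
      = L.brk (lam + mu) (D.app lam a) b + L.brk mu a (D.app lam b)

/-- Conformal quasiderivations: `[(D_λ a)_{λ+μ} b] + [a_μ (D_λ b)] = D'_λ([a_μ b])`. -/
def IsQDer (D : CLin L) : Prop :=
  ∃ D' : CLin L, ∀ (lam mu : ℂ) (a b : R),
    L.brk (lam + mu) (D.app lam a) b + L.brk mu a (D.app lam b)
      = D'.app lam (L.brk mu a b)

/-- Generalized conformal derivations:
`[(D_λ a)_{λ+μ} b] + [a_μ (D'_λ b)] = D''_λ([a_μ b])`. -/
def IsGDer (D : CLin L) : Prop :=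
  ∃ D' D'' : CLin L, ∀ (lam mu : ℂ) (a b : R),
    L.brk (lam + mu) (D.app lam a) b + L.brk mu a (D'.app lam b)
      = D''.app lam (L.brk mu a b)

/-- The conformal centroid: `D_λ([a_μ b]) = [(D_λ a)_{λ+μ} b] = [a_μ (D_λ b)]`. -/
def IsCent (D : CLin L) : Prop :=
  ∀ (lam mu : ℂ) (a b : R),
    D.app lam (L.brk mu a b) = L.brk (lam + mu) (D.app lam a) b ∧
    L.brk (lam + mu) (D.app lam a) b = L.brk mu a (D.app lam b)

/-- The conformal quasicentroid: `[(D_λ a)_{λ+μ} b] = [a_μ (D_λ b)]`. -/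
def IsQC (D : CLin L) : Prop :=
  ∀ (lam mu : ℂ) (a b : R),
    L.brk (lam + mu) (D.app lam a) b = L.brk mu a (D.app lam b)

/-- `ZDer(R)`: `[(D_λ a)_μ b] = D_λ([a_μ b]) = 0`. -/
def IsZDer (D : CLin L) : Prop :=
  ∀ (lam mu : ℂ) (a b : R),
    L.brk mu (D.app lam a) b = 0 ∧ D.app lam (L.brk mu a b) = 0

/-- `F` is the family of `λ`-coefficients of the bracket `[D₁ _λ D₂]` of `gc(R)`, i.e.
`[D₁ _λ D₂]_μ (a) = D₁_λ(D₂_{μ-λ}(a)) - D₂_{μ-λ}(D₁_λ(a)) = ∑ λ^n • (F n)_μ(a)`,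
with `F` eventually zero. -/
def RepBracket (D₁ D₂ : CLin L) (F : ℕ → CLin L) : Prop :=
  (∃ N : ℕ, ∀ n : ℕ, N ≤ n → ∀ (lam : ℂ) (a : R), (F n).app lam a = 0) ∧
  ∀ (lam mu : ℂ) (a : R),
    D₁.app lam (D₂.app (mu - lam) a) - D₂.app (mu - lam) (D₁.app lam a)
      = ∑ᶠ n : ℕ, lam ^ n • (F n).app mu a

end

open Polynomial in
/-- A linear operator on `ℂ[X]` intertwining multiplication by `X` with multiplication by `g`
is determined by its value at `1`. -/
theorem linearMap_eq_comp_mul (T : ℂ[X] →ₗ[ℂ] ℂ[X]) (g : ℂ[X])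
    (hT : ∀ p, T (X * p) = g * T p) (p : ℂ[X]) : T p = p.comp g * T 1 := by
  have hpow : ∀ n : ℕ, T (X ^ n) = g ^ n * T 1 := by
    intro n
    induction n with
    | zero => simp
    | succ k ih => rw [pow_succ', hT, ih, pow_succ', mul_assoc]
  induction p using Polynomial.induction_on' with
  | add p q hp hq => rw [map_add, hp, hq, add_comp, add_mul]
  | monomial n a =>
    rw [← C_mul_X_pow_eq_monomial, ← smul_eq_C_mul, map_smul, hpow, smul_comp, X_pow_comp,
      smul_mul_assoc]

theorem finsum_pow_smul_eq_sum {M : Type*} [AddCommGroup M] [Module ℂ M] (lam : ℂ) {c : ℕ → M}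
    {N : ℕ} (hN : ∀ n, N ≤ n → c n = 0) :
    ∑ᶠ n : ℕ, lam ^ n • c n = ∑ n ∈ Finset.range N, lam ^ n • c n := by
  refine finsum_eq_sum_of_support_subset _ fun n hn => ?_
  simp only [Finset.coe_range, Set.mem_Iio]
  by_contra! h
  exact hn (by simp [hN n h])

theorem isLinearMap_finsum_pow_smul {M : Type*} [AddCommGroup M] [Module ℂ M] (lam : ℂ)
    (c : ℕ → M →ₗ[ℂ] M) (hc : ∀ a, ∃ N : ℕ, ∀ n, N ≤ n → c n a = 0) :
    IsLinearMap ℂ fun a => ∑ᶠ n : ℕ, lam ^ n • c n a where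
  map_add a b := by
    obtain ⟨N, hN⟩ := hc a
    obtain ⟨K, hK⟩ := hc b
    have ha : ∀ n, max N K ≤ n → c n a = 0 := fun n hn => hN n (le_trans (le_max_left _ _) hn)
    have hb : ∀ n, max N K ≤ n → c n b = 0 := fun n hn => hK n (le_trans (le_max_right _ _) hn)
    have hab : ∀ n, max N K ≤ n → c n (a + b) = 0 := fun n hn => by
      rw [map_add, ha n hn, hb n hn, add_zero]
    rw [finsum_pow_smul_eq_sum lam ha, finsum_pow_smul_eq_sum lam hb,
      finsum_pow_smul_eq_sum lam hab]
    simp only [map_add, smul_add, Finset.sum_add_distrib]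
  map_smul r a := by
    obtain ⟨N, hN⟩ := hc a
    have hr : ∀ n, N ≤ n → c n (r • a) = 0 := fun n hn => by rw [map_smul, hN n hn, smul_zero]
    rw [finsum_pow_smul_eq_sum lam hN, finsum_pow_smul_eq_sum lam hr]
    simp only [map_smul, Finset.smul_sum, smul_comm r]

section Virasoro

open Polynomial

variable {V : LieConformalAlgebra ℂ[X]}

theorem CLin.app_eq_comp_mul (hd : ∀ p : ℂ[X], V.d p = X * p) (D : CLin V) (lam : ℂ) (p : ℂ[X]) :
    D.app lam p = p.comp (X + C lam) * D.app lam 1 := by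
  refine linearMap_eq_comp_mul
    (IsLinearMap.mk' _ (isLinearMap_finsum_pow_smul lam D.coeff D.locality)) _ (fun q => ?_) p
  have h := D.conf lam q
  simp only [hd] at h
  simp only [IsLinearMap.mk'_apply]
  rw [h, smul_eq_C_mul, add_mul]

theorem virasoro_brk_eq (hd : ∀ p : ℂ[X], V.d p = X * p)
    (hL : ∀ lam : ℂ, V.brk lam 1 1 = X + C (2 * lam)) (lam : ℂ) (p q : ℂ[X]) :
    V.brk lam p q = C (p.eval (-lam)) * (q.comp (X + C lam) * (X + C (2 * lam))) := by
  have hl : V.brk lam p q = p.comp (C (-lam)) * V.brk lam 1 q := by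
    refine linearMap_eq_comp_mul (IsLinearMap.mk' _ (isLinearMap_finsum_pow_smul lam
      (fun n => (V.coeff n).flip q) fun a => V.locality a q)) _ (fun r => ?_) p
    have h := V.sesq_left lam r q
    rw [hd, ← neg_smul, smul_eq_C_mul] at h
    exact h
  have hr : V.brk lam 1 q = q.comp (X + C lam) * V.brk lam 1 1 := by
    refine linearMap_eq_comp_mul (IsLinearMap.mk' _ (isLinearMap_finsum_pow_smul lam
      (fun n => V.coeff n 1) fun a => V.locality 1 a)) _ (fun r => ?_) q
    have h := V.sesq_right lam 1 r
    rw [hd, hd, smul_eq_C_mul, ← add_mul] at h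
    exact h
  rw [hl, hr, hL, comp_C]

/-- The `λ`-coefficients of `p ↦ p(∂ + λ) f(λ, ∂)`, where the outer variable of `f` is `λ`
and the inner one is `∂`. -/
noncomputable def shiftMulCoeff (f : ℂ[X][X]) (n : ℕ) : ℂ[X] →ₗ[ℂ] ℂ[X] :=
  ((lcoeff ℂ[X] n).restrictScalars ℂ) ∘ₗ LinearMap.mulRight ℂ f ∘ₗ
    (aeval (X + C X : ℂ[X][X])).toLinearMap

theorem shiftMulCoeff_apply (f : ℂ[X][X]) (n : ℕ) (p : ℂ[X]) :
    shiftMulCoeff f n p = (aeval (X + C X : ℂ[X][X]) p * f).coeff n := rfl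

theorem shiftMulCoeff_eq_zero (f : ℂ[X][X]) (p : ℂ[X]) {n : ℕ}
    (hn : (aeval (X + C X : ℂ[X][X]) p * f).natDegree + 1 ≤ n) : shiftMulCoeff f n p = 0 :=
  coeff_eq_zero_of_natDegree_lt hn

theorem finsum_shiftMulCoeff (f : ℂ[X][X]) (lam : ℂ) (p : ℂ[X]) :
    ∑ᶠ n : ℕ, lam ^ n • shiftMulCoeff f n p = p.comp (X + C lam) * f.eval (C lam) := by
  have he : (aeval (X + C X : ℂ[X][X]) p).eval (C lam) = p.comp (X + C lam) := by
    have h := aeval_algHom_apply ((aeval (C lam : ℂ[X])).restrictScalars ℂ : ℂ[X][X] →ₐ[ℂ] ℂ[X])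
      (X + C X) p
    simp only [AlgHom.coe_restrictScalars', map_add, aeval_X, aeval_C, Algebra.algebraMap_self,
      RingHom.id_apply, coe_aeval_eq_eval] at h
    rw [← h, add_comm, comp_eq_aeval]
  rw [finsum_pow_smul_eq_sum lam fun n hn => shiftMulCoeff_eq_zero f p hn, ← he, ← eval_mul,
    eval_eq_sum_range]
  refine Finset.sum_congr rfl fun n _ => ?_
  rw [shiftMulCoeff_apply, smul_eq_C_mul, C_pow, mul_comm]

/-- The conformal linear map with `D_λ(L) = f(λ, ∂) L`. -/
noncomputable def CLin.ofPolynomial (hd : ∀ p : ℂ[X], V.d p = X * p) (f : ℂ[X][X]) : CLin V where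
  coeff := shiftMulCoeff f
  locality p := ⟨_, fun _ hn => shiftMulCoeff_eq_zero f p hn⟩
  conf lam p := by
    rw [hd, hd, finsum_shiftMulCoeff, finsum_shiftMulCoeff, mul_comp, X_comp, smul_eq_C_mul]
    ring

theorem CLin.ofPolynomial_app (hd : ∀ p : ℂ[X], V.d p = X * p) (f : ℂ[X][X]) (lam : ℂ)
    (p : ℂ[X]) :
    (CLin.ofPolynomial hd f).app lam p = p.comp (X + C lam) * f.eval (C lam) :=
  finsum_shiftMulCoeff f lam p

theorem CLin.exists_eval_eq_coeff_app (D : CLin V) (p : ℂ[X]) (k : ℕ) :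
    ∃ b : ℂ[X], ∀ lam : ℂ, b.eval lam = (D.app lam p).coeff k := by
  obtain ⟨N, hN⟩ := D.locality p
  refine ⟨∑ n ∈ Finset.range N, monomial n ((D.coeff n p).coeff k), fun lam => ?_⟩
  rw [CLin.app, finsum_pow_smul_eq_sum lam hN, eval_finsetSum, finsetSum_coeff]
  refine Finset.sum_congr rfl fun n _ => ?_
  rw [eval_monomial, coeff_smul, smul_eq_mul, mul_comm]

/-- Leading terms: the functional equation forces `2 = 2 ^ n` if `F` has degree `n ≥ 2`. -/
theorem natDegree_le_one_of_functional_eq {F : ℂ[X]} {lam c : ℂ}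
    (h : ∀ s : ℂ, s * (c + F.eval s - 2 * F.eval ((s - lam) / 2)) = lam * (F.eval s - c)) :
    F.natDegree ≤ 1 := by
  by_contra! hn
  have hpoly : X * (C c + F - C 2 * F.comp (C 2⁻¹ * X + C (-lam / 2))) = C lam * (F - C c) := by
    refine Polynomial.funext fun s => ?_
    have hs : (2⁻¹ : ℂ) * s + -lam / 2 = (s - lam) / 2 := by ring
    simpa [eval_comp, hs] using h s
  have hlin : (C (2⁻¹ : ℂ) * X + C (-lam / 2)).natDegree = 1 :=
    natDegree_linear (by norm_num)
  have hlead := coeff_comp_degree_mul_degree (p := F) (q := C (2⁻¹ : ℂ) * X + C (-lam / 2))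
    (by rw [hlin]; norm_num)
  rw [hlin, mul_one, leadingCoeff_linear (by norm_num)] at hlead
  have hcoeff := congrArg (fun P => coeff P (F.natDegree + 1)) hpoly
  simp only [coeff_X_mul, coeff_C_mul, coeff_sub, coeff_add, hlead, coeff_natDegree,
    coeff_eq_zero_of_natDegree_lt (Nat.lt_succ_self F.natDegree), coeff_C,
    if_neg (show F.natDegree ≠ 0 by omega), Nat.succ_ne_zero, if_false, sub_zero, mul_zero,
    zero_add] at hcoeff
  have hF : F.leadingCoeff ≠ 0 := leadingCoeff_ne_zero.mpr (by rintro rfl; simp at hn)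
  have hpow : (2 : ℂ) ^ F.natDegree = 2 := by
    have h1 : F.leadingCoeff * (1 - 2 * (2⁻¹ : ℂ) ^ F.natDegree) = 0 := by
      linear_combination hcoeff
    have h2 := (mul_eq_zero.mp h1).resolve_left hF
    rw [inv_pow] at h2
    field_simp at h2
    linear_combination h2
  have hnat : 2 ^ F.natDegree = 2 := by exact_mod_cast hpow
  have := Nat.pow_lt_pow_right (a := 2) (by norm_num) hn
  omega

/-- The generalized derivation identity on the generator, with `F = f(λ, ·)`, `G = f'(λ, ·)` and
`H = f''(λ, ·)`, forces `F` to be affine as soon as `λ ≠ 0`. -/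
theorem natDegree_le_one_of_gder_eq {F G H : ℂ[X]} {lam : ℂ} (hlam : lam ≠ 0)
    (h : ∀ x mu : ℂ, F.eval (-(lam + mu)) * (x + 2 * (lam + mu)) + G.eval (x + mu) * (x + 2 * mu)
      = (x + lam + 2 * mu) * H.eval x) :
    F.natDegree ≤ 1 := by
  have hG : ∀ t, G.eval t = F.eval t := fun t => by
    have h1 := h (2 * t + lam) (-lam - t)
    rw [show -(lam + (-lam - t)) = t by ring, show 2 * t + lam + (-lam - t) = t by ring] at h1
    exact mul_left_cancel₀ hlam (by linear_combination -h1)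
  have hH : ∀ u, H.eval (2 * u) = 2 * F.eval (u - lam) := fun u => by
    have h1 := h (2 * u) (-u)
    rw [show -(lam + -u) = u - lam by ring] at h1
    exact mul_left_cancel₀ hlam (by linear_combination -h1)
  refine natDegree_le_one_of_functional_eq (lam := lam) (c := F.eval 0) fun s => ?_
  have h1 := h (s + lam) (-lam)
  have h2 := hH ((s + lam) / 2)
  rw [show 2 * ((s + lam) / 2) = s + lam by ring,
    show (s + lam) / 2 - lam = (s - lam) / 2 by ring] at h2
  rw [show -(lam + -lam) = 0 by ring, show s + lam + -lam = s by ring, hG, h2] at h1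
  linear_combination h1

theorem IsQDer.isGDer {D : CLin V} (h : IsQDer D) : IsGDer D :=
  let ⟨D', hD'⟩ := h
  ⟨D, D', hD'⟩

theorem IsGDer.exists_app_one_eq (hd : ∀ p : ℂ[X], V.d p = X * p)
    (hL : ∀ lam : ℂ, V.brk lam 1 1 = X + C (2 * lam)) {D : CLin V} (hD : IsGDer D) :
    ∃ a₀ a₁ : ℂ[X], ∀ lam : ℂ, D.app lam 1 = C (a₀.eval lam) + C (a₁.eval lam) * X := by
  obtain ⟨D', D'', h⟩ := hD
  have hdeg : ∀ lam : ℂ, lam ≠ 0 → (D.app lam 1).natDegree ≤ 1 := fun lam hlam => by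
    refine natDegree_le_one_of_gder_eq (G := D'.app lam 1) (H := D''.app lam 1) hlam fun x mu => ?_
    have h1 := congrArg (eval x) (h lam mu 1 1)
    rw [hL, CLin.app_eq_comp_mul hd D'', virasoro_brk_eq hd hL, virasoro_brk_eq hd hL] at h1
    simp only [eval_add, eval_mul, eval_C, eval_comp, eval_X, eval_one, add_comp, X_comp, C_comp]
      at h1
    linear_combination h1
  choose b hb using D.exists_eval_eq_coeff_app 1
  have hb0 : ∀ k, 2 ≤ k → b k = 0 := fun k hk => by
    have hX : X * b k = 0 := Polynomial.funext fun lam => by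
      rcases eq_or_ne lam 0 with rfl | hlam
      · simp
      · have := hdeg lam hlam
        simp [hb, coeff_eq_zero_of_natDegree_lt (show (D.app lam 1).natDegree < k by omega)]
    exact (mul_eq_zero.mp hX).resolve_left X_ne_zero
  refine ⟨b 0, b 1, fun lam => ?_⟩
  have h1 : (D.app lam 1).natDegree ≤ 1 := natDegree_le_iff_coeff_eq_zero.mpr fun k hk => by
    rw [← hb, hb0 k hk, eval_zero]
  rw [hb, hb, add_comm]
  exact eq_X_add_C_of_natDegree_le_one h1

theorem isQDer_of_app_one_eq (hd : ∀ p : ℂ[X], V.d p = X * p)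
    (hL : ∀ lam : ℂ, V.brk lam 1 1 = X + C (2 * lam)) {D : CLin V} {a₀ a₁ : ℂ[X]}
    (h : ∀ lam : ℂ, D.app lam 1 = C (a₀.eval lam) + C (a₁.eval lam) * X) : IsQDer D := by
  refine ⟨CLin.ofPolynomial hd
    (2 * a₀.map C + a₁.map C * C X - 2 * X * a₁.map C), fun lam mu p q => ?_⟩
  refine Polynomial.funext fun x => ?_
  rw [CLin.ofPolynomial_app, CLin.app_eq_comp_mul hd D lam p, CLin.app_eq_comp_mul hd D lam q, h,
    virasoro_brk_eq hd hL, virasoro_brk_eq hd hL, virasoro_brk_eq hd hL]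
  simp only [eval_add, eval_sub, eval_mul, eval_C, eval_comp, eval_X, mul_comp, add_comp, X_comp,
    C_comp, eval_map, eval₂_at_apply, eval_ofNat]
  rw [show -(lam + mu) + lam = -mu by ring, show x + lam + mu = x + (lam + mu) by ring,
    show x + mu + lam = x + (lam + mu) by ring]
  ring

end Virasoro

/-- For the Virasoro Lie conformal algebra `Vir = ℂ[∂]L` (modelled on
`Polynomial ℂ` with `∂ = (X * ·)` and `L = 1`, `[L_λ L] = (∂ + 2λ)L`):
`GDer(Vir) = QDer(Vir) = {D : D_λ(L) = (a₀(λ) + a₁(λ)∂)L}`. -/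
theorem stmt0 (V : LieConformalAlgebra (Polynomial ℂ))
    (hd : ∀ p : Polynomial ℂ, V.d p = Polynomial.X * p)
    (hL : ∀ lam : ℂ, V.brk lam 1 1 = Polynomial.X + Polynomial.C (2 * lam)) :
    {D : CLin V | IsGDer D} = {D : CLin V | IsQDer D} ∧
    {D : CLin V | IsGDer D}
      = {D : CLin V | ∃ a₀ a₁ : Polynomial ℂ, ∀ lam : ℂ,
          D.app lam 1 = Polynomial.C (a₀.eval lam) + Polynomial.C (a₁.eval lam) * Polynomial.X} := by
  have key : ∀ D : CLin V, IsGDer D → IsQDer D := fun D hD =>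
    let ⟨_, _, h⟩ := hD.exists_app_one_eq hd hL
    isQDer_of_app_one_eq hd hL h
  refine ⟨Set.ext fun D => ⟨key D, IsQDer.isGDer⟩, Set.ext fun D =>
    ⟨fun hD => IsGDer.exists_app_one_eq hd hL hD, ?_⟩⟩
  rintro ⟨a₀, a₁, h⟩
  exact (isQDer_of_app_one_eq hd hL h).isGDer
end

section
/- For the Virasoro Lie conformal algebra Vir, the conformal centroid and the conformal quasicentroid are both zero: C(Vir) = QC(Vir) = 0. -/
open scoped BigOperators

universe u

open Polynomial in
/-- A linear endomorphism of `ℂ[X]` intertwining multiplication by `X` with multiplication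
by `q` is determined by its value at `1`. -/
theorem linearMap_apply_eq_aeval_mul (T : ℂ[X] →ₗ[ℂ] ℂ[X]) (q : ℂ[X])
    (h : ∀ p, T (X * p) = q * T p) (p : ℂ[X]) : T p = aeval q p * T 1 := by
  induction p using Polynomial.induction_on' with
  | add p r hp hr => simp only [map_add, add_mul, hp, hr]
  | monomial n a =>
    have hpow : T (X ^ n) = q ^ n * T 1 := by
      induction n with
      | zero => simp
      | succ n ih => rw [pow_succ', h, ih, pow_succ', mul_assoc]
    rw [← smul_X_eq_monomial, map_smul, hpow, map_smul, map_pow, aeval_X, smul_mul_assoc]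

section Generating

variable {R : Type u} [AddCommGroup R] [Module ℂ R]

/-- The evaluation at `lam` of the generating polynomial `∑ λ^n • f n` of a pointwise
eventually vanishing sequence of linear maps. -/
noncomputable def generatingEval (f : ℕ → R →ₗ[ℂ] R)
    (hf : ∀ a : R, ∃ N : ℕ, ∀ n : ℕ, N ≤ n → f n a = 0) (lam : ℂ) : R →ₗ[ℂ] R :=
  have hfin (a : R) : (Function.support fun n : ℕ => lam ^ n • f n a).Finite := by
    obtain ⟨N, hN⟩ := hf a
    refine (Set.finite_Iio N).subset fun n hn => ?_
    by_contra h
    exact hn (by simp [hN n (not_lt.mp h)])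
  { toFun := fun a => ∑ᶠ n : ℕ, lam ^ n • f n a
    map_add' := fun a b => by
      simp only [map_add, smul_add]
      exact finsum_add_distrib (hfin a) (hfin b)
    map_smul' := fun c a => by
      simp only [map_smul, RingHom.id_apply, smul_finsum, smul_comm c] }

variable {V : LieConformalAlgebra R}

theorem LieConformalAlgebra.brk_zero_left (lam : ℂ) (b : R) : V.brk lam 0 b = 0 := by
  simp [LieConformalData.brk]

theorem LieConformalAlgebra.brk_zero_right (lam : ℂ) (a : R) : V.brk lam a 0 = 0 := by
  simp [LieConformalData.brk]

theorem IsCent.isQC {D : CLin V} (hD : IsCent D) : IsQC D :=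
  fun lam mu a b => (hD lam mu a b).2

theorem isCent_of_app_eq_zero {D : CLin V} (hD : ∀ (lam : ℂ) (a : R), D.app lam a = 0) :
    IsCent D := fun lam mu a b => by
  simp [hD, LieConformalAlgebra.brk_zero_left, LieConformalAlgebra.brk_zero_right]

end Generating

section RankOne

open Polynomial

variable {V : LieConformalAlgebra ℂ[X]}

theorem brk_eq_eval_mul (hd : ∀ p : ℂ[X], V.d p = X * p) (lam : ℂ) (p b : ℂ[X]) :
    V.brk lam p b = C (p.eval (-lam)) * V.brk lam 1 b := by
  have h := linearMap_apply_eq_aeval_mul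
    (generatingEval (fun n => (V.coeff n).flip b) (fun a => V.locality a b) lam) (C (-lam))
    (fun p => by
      have := V.sesq_left lam p b
      rw [hd, ← neg_smul, smul_eq_C_mul] at this
      exact this) p
  rw [show aeval (C (-lam)) p = C (p.eval (-lam)) from
    (aeval_algebraMap_apply ℂ[X] (-lam) p).trans (by simp [coe_aeval_eq_eval])] at h
  exact h

theorem brk_eq_comp_mul (hd : ∀ p : ℂ[X], V.d p = X * p) (lam : ℂ) (a p : ℂ[X]) :
    V.brk lam a p = p.comp (X + C lam) * V.brk lam a 1 :=
  linearMap_apply_eq_aeval_mul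
    (generatingEval (fun n => V.coeff n a) (fun b => V.locality a b) lam) (X + C lam)
    (fun p => by
      have := V.sesq_right lam a p
      rw [hd, hd, smul_eq_C_mul, ← add_mul] at this
      exact this) p

/-- `D_λ(a)` is polynomial in `λ`, so it vanishes at `0` if it vanishes elsewhere. -/
theorem CLin.app_eq_zero_of_forall_ne (D : CLin V) (a : ℂ[X])
    (h : ∀ lam : ℂ, lam ≠ 0 → D.app lam a = 0) (lam : ℂ) : D.app lam a = 0 := by
  obtain ⟨N, hN⟩ := D.locality a
  let Q : ℂ[X][X] := ∑ n ∈ Finset.range N, monomial n (D.coeff n a)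
  have hQ (z : ℂ) : Q.eval (C z) = D.app z a := by
    rw [CLin.app, finsum_eq_sum_of_support_subset (s := Finset.range N)]
    · simp only [Q, eval_finsetSum, eval_monomial, smul_eq_C_mul, C_pow, mul_comm]
    · intro n hn
      by_contra hlt
      exact hn (by simp [hN n (by simpa using hlt)])
  have hzero : Q = 0 := by
    refine eq_zero_of_infinite_isRoot Q (Set.Infinite.mono ?_
      ((Set.finite_singleton (0 : ℂ)).infinite_compl.image (C_injective.injOn)))
    rintro _ ⟨z, hz, rfl⟩
    exact (hQ z).trans (h z hz)
  rw [← hQ, hzero, eval_zero]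

theorem IsQC.app_eq_zero (hd : ∀ p : ℂ[X], V.d p = X * p)
    (hL : ∀ lam : ℂ, V.brk lam 1 1 = X + C (2 * lam)) {D : CLin V} (hD : IsQC D)
    (lam : ℂ) (a : ℂ[X]) : D.app lam a = 0 := by
  rw [D.app_eq_comp_mul hd, D.app_eq_zero_of_forall_ne 1 (fun z hz => ?_) lam, mul_zero]
  refine Polynomial.funext fun x => ?_
  have h := congrArg (eval (2 * (z + x))) (hD z (-z - x) 1 1)
  rw [brk_eq_eval_mul hd, brk_eq_comp_mul hd _ 1 (D.app z 1), hL, hL] at h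
  simp only [eval_mul, eval_add, eval_X, eval_C] at h
  have hx : (D.app z 1).eval x * (2 * z) = 0 := by
    rw [show -(z + (-z - x)) = x by ring] at h
    linear_combination h
  simpa [hz] using hx

end RankOne

/-- For the Virasoro Lie conformal algebra, the conformal centroid and
the conformal quasicentroid are both zero: `C(Vir) = QC(Vir) = 0`. -/
theorem stmt1 (V : LieConformalAlgebra (Polynomial ℂ))
    (hd : ∀ p : Polynomial ℂ, V.d p = Polynomial.X * p)
    (hL : ∀ lam : ℂ, V.brk lam 1 1 = Polynomial.X + Polynomial.C (2 * lam)) :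
    {D : CLin V | IsCent D} = {D : CLin V | ∀ (lam : ℂ) (a : Polynomial ℂ), D.app lam a = 0} ∧
    {D : CLin V | IsQC D} = {D : CLin V | ∀ (lam : ℂ) (a : Polynomial ℂ), D.app lam a = 0} := by
  constructor <;> ext D
  · exact ⟨fun h => h.isQC.app_eq_zero hd hL, isCent_of_app_eq_zero⟩
  · exact ⟨fun h => h.app_eq_zero hd hL, fun h => (isCent_of_app_eq_zero h).isQC⟩
end

section
/- Let R be a Lie conformal algebra with trivial center, Z(R) = 0. Then C(R) is a commutative Lie conformal subalgebra of GDer(R): C(R) ⊆ GDer(R), and for all D₁, D₂ ∈ C(R), [D₁ _λ D₂] = 0. -/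
open scoped BigOperators

universe u

/-- The family of coefficients of the `λ`-bracket of two elements is finitely supported. -/
theorem LieConformalData.finite_support_brk {R : Type u} [AddCommGroup R] [Module ℂ R]
    (L : LieConformalData R) (lam : ℂ) (a b : R) :
    (Function.support fun n : ℕ => lam ^ n • L.coeff n a b).Finite := by
  obtain ⟨N, hN⟩ := L.locality a b
  refine (Set.finite_lt_nat N).subset fun n hn => ?_
  by_contra h
  exact hn (by simp [hN n (not_lt.mp h)])

theorem LieConformalData.brk_sub_left {R : Type u} [AddCommGroup R] [Module ℂ R]
    (L : LieConformalData R) (lam : ℂ) (x y b : R) :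
    L.brk lam (x - y) b = L.brk lam x b - L.brk lam y b := by
  unfold LieConformalData.brk
  rw [← finsum_sub_distrib (L.finite_support_brk lam x b) (L.finite_support_brk lam y b)]
  simp [smul_sub]

theorem LieConformalData.brk_zero_right {R : Type u} [AddCommGroup R] [Module ℂ R]
    (L : LieConformalData R) (lam : ℂ) (a : R) : L.brk lam a 0 = 0 := by
  simp [LieConformalData.brk]

/-- The zero conformal linear map. -/
def CLin.zero {R : Type u} [AddCommGroup R] [Module ℂ R] (L : LieConformalAlgebra R) :
    CLin L where
  coeff _ := 0
  locality _ := ⟨0, by simp⟩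
  conf := by simp

theorem CLin.zero_app {R : Type u} [AddCommGroup R] [Module ℂ R] (L : LieConformalAlgebra R)
    (lam : ℂ) (a : R) : (CLin.zero L).app lam a = 0 := by
  simp [CLin.app, CLin.zero]

theorem IsCent.isGDer {R : Type u} [AddCommGroup R] [Module ℂ R] {L : LieConformalAlgebra R}
    {D : CLin L} (hD : IsCent D) : IsGDer D :=
  ⟨CLin.zero L, D, fun lam mu a b => by
    rw [CLin.zero_app, LieConformalData.brk_zero_right, add_zero, (hD lam mu a b).1]⟩

/-- Composing two elements of the centroid in either order gives the same bracket with every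
element of the algebra. -/
theorem IsCent.brk_app_app_comm {R : Type u} [AddCommGroup R] [Module ℂ R]
    {L : LieConformalAlgebra R} {D₁ D₂ : CLin L} (h₁ : IsCent D₁) (h₂ : IsCent D₂)
    (lam nu mu : ℂ) (a b : R) :
    L.brk (lam + nu + mu) (D₁.app lam (D₂.app nu a)) b
      = L.brk (lam + nu + mu) (D₂.app nu (D₁.app lam a)) b := by
  calc L.brk (lam + nu + mu) (D₁.app lam (D₂.app nu a)) b
      = D₁.app lam (D₂.app nu (L.brk mu a b)) := by
        rw [add_assoc, ← (h₁ lam (nu + mu) _ b).1, ← (h₂ nu mu a b).1]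
    _ = D₁.app lam (L.brk mu a (D₂.app nu b)) := by
        rw [(h₂ nu mu a b).1, (h₂ nu mu a b).2]
    _ = L.brk (lam + nu + mu) (D₂.app nu (D₁.app lam a)) b := by
        rw [(h₁ lam mu a _).1, ← (h₂ nu (lam + mu) _ b).2, add_left_comm, add_assoc]

/-- If `Z(R) = 0`, then `C(R)` is a commutative Lie conformal
subalgebra of `GDer(R)`: `C(R) ⊆ GDer(R)` and `[D₁ _λ D₂] = 0` for `D₁, D₂ ∈ C(R)`. -/
theorem stmt6 {R : Type u} [AddCommGroup R] [Module ℂ R] (L : LieConformalAlgebra R)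
    (hZ : ∀ a : R, (∀ (lam : ℂ) (b : R), L.brk lam a b = 0) → a = 0) :
    (∀ D : CLin L, IsCent D → IsGDer D) ∧
    (∀ D₁ D₂ : CLin L, IsCent D₁ → IsCent D₂ → ∀ (lam mu : ℂ) (a : R),
      D₁.app lam (D₂.app (mu - lam) a) - D₂.app (mu - lam) (D₁.app lam a) = 0) := by
  refine ⟨fun D hD => hD.isGDer, fun D₁ D₂ h₁ h₂ lam mu a => hZ _ fun kap b => ?_⟩
  have h := h₁.brk_app_app_comm h₂ lam (mu - lam) (kap - mu) a b
  rw [show lam + (mu - lam) + (kap - mu) = kap by ring] at h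
  rw [LieConformalData.brk_sub_left, h, sub_self]
end

section
/- For any Lie conformal algebra R, GDer(R) = QDer(R) + QC(R): every generalized conformal derivation of R is the sum of a conformal quasiderivation and a conformal quasicentroid element, and conversely every such sum is a generalized conformal derivation. -/
open scoped BigOperators

universe u

section

variable {R : Type u} [AddCommGroup R] [Module ℂ R]

open Polynomial in
/-- An `R`-valued polynomial identity valid at all scalars remains valid after substituting
an endomorphism of `R` for the variable. -/
theorem sum_aeval_apply_eq_zero {ι : Type*} (s : Finset ι) (p : ι → ℂ[X]) (v : ι → R)
    (h : ∀ x : ℂ, ∑ i ∈ s, (p i).eval x • v i = 0) (T : Module.End ℂ R) :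
    ∑ i ∈ s, aeval T (p i) (v i) = 0 := by
  have hcoeff (k : ℕ) : ∑ i ∈ s, (p i).coeff k • v i = 0 := by
    rw [← Module.forall_dual_apply_eq_zero_iff ℂ]
    intro φ
    have hpoly : ∑ i ∈ s, φ (v i) • p i = 0 := by
      refine Polynomial.funext fun x => ?_
      simpa [eval_finsetSum, mul_comm] using congrArg φ (h x)
    simpa [mul_comm] using congrArg (fun q => q.coeff k) hpoly
  let M := s.sup (fun i => (p i).natDegree) + 1
  have hM : ∀ i ∈ s, (p i).natDegree < M := fun i hi =>
    Nat.lt_succ_of_le (Finset.le_sup (f := fun i => (p i).natDegree) hi)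
  calc ∑ i ∈ s, aeval T (p i) (v i)
      = ∑ i ∈ s, ∑ k ∈ Finset.range M, (T ^ k) ((p i).coeff k • v i) := by
        refine Finset.sum_congr rfl fun i hi => ?_
        rw [aeval_eq_sum_range' (hM i hi)]
        simp
    _ = ∑ k ∈ Finset.range M, (T ^ k) (∑ i ∈ s, (p i).coeff k • v i) := by
        rw [Finset.sum_comm]
        simp only [map_sum]
    _ = 0 := by simp [hcoeff]

theorem finsum_eq_sum_range {M : Type*} [AddCommMonoid M] {f : ℕ → M} {N : ℕ}
    (hf : ∀ n, N ≤ n → f n = 0) : ∑ᶠ n, f n = ∑ n ∈ Finset.range N, f n := by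
  refine finsum_eq_sum_of_support_subset _ fun n hn => ?_
  by_contra hN
  exact hn (hf n (by simpa using hN))

theorem finsum_pow_smul_linear_combination {f g : ℕ → R}
    (hf : ∃ N : ℕ, ∀ n, N ≤ n → f n = 0) (hg : ∃ N : ℕ, ∀ n, N ≤ n → g n = 0) (x c e : ℂ) :
    ∑ᶠ n : ℕ, x ^ n • (c • f n + e • g n)
      = c • (∑ᶠ n : ℕ, x ^ n • f n) + e • ∑ᶠ n : ℕ, x ^ n • g n := by
  obtain ⟨N, hN⟩ := hf
  obtain ⟨N', hN'⟩ := hg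
  rw [finsum_eq_sum_range (N := max N N') fun n hn => ?_,
    finsum_eq_sum_range (N := max N N') fun n hn => ?_,
    finsum_eq_sum_range (N := max N N') fun n hn => ?_]
  · simp only [Finset.smul_sum, ← Finset.sum_add_distrib, smul_add, smul_comm (x ^ _)]
  · rw [hN' n (le_of_max_le_right hn), smul_zero]
  · rw [hN n (le_of_max_le_left hn), smul_zero]
  · rw [hN n (le_of_max_le_left hn), hN' n (le_of_max_le_right hn)]
    simp

namespace LieConformalData

variable (L : LieConformalData R)

theorem brk_linear_combination_left (x c e : ℂ) (a a' b : R) :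
    L.brk x (c • a + e • a') b = c • L.brk x a b + e • L.brk x a' b := by
  simpa [brk] using finsum_pow_smul_linear_combination (L.locality a b) (L.locality a' b) x c e

theorem brk_linear_combination_right (x c e : ℂ) (a b b' : R) :
    L.brk x a (c • b + e • b') = c • L.brk x a b + e • L.brk x a b' := by
  simpa [brk] using finsum_pow_smul_linear_combination (L.locality a b) (L.locality a b') x c e

theorem brk_eq_sum_range {a b : R} {N : ℕ} (h : ∀ n, N ≤ n → L.coeff n a b = 0) (x : ℂ) :
    L.brk x a b = ∑ n ∈ Finset.range N, x ^ n • L.coeff n a b :=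
  finsum_eq_sum_range fun n hn => by rw [h n hn, smul_zero]

end LieConformalData

theorem LieConformalAlgebra.brk_eq_neg_sum_range (L : LieConformalAlgebra R) {a b : R} {N : ℕ}
    (h : ∀ n, N ≤ n → L.coeff n b a = 0) (x : ℂ) :
    L.brk x a b = -∑ n ∈ Finset.range N,
      ((((-x) • (LinearMap.id : R →ₗ[ℂ] R)) - L.d) ^ n) (L.coeff n b a) := by
  rw [L.skew, finsum_eq_sum_range fun n hn => by rw [h n hn, map_zero]]

namespace CLin

variable {L : LieConformalAlgebra R}

/-- The linear map `a ↦ D_λ(a)`. -/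
noncomputable def appLin (D : CLin L) (x : ℂ) : R →ₗ[ℂ] R :=
  have h (c e : ℂ) (a b : R) : D.app x (c • a + e • b) = c • D.app x a + e • D.app x b := by
    simpa [app] using finsum_pow_smul_linear_combination (D.locality a) (D.locality b) x c e
  { toFun := D.app x
    map_add' := fun a b => by simpa using h 1 1 a b
    map_smul' := fun c a => by simpa using h c 0 a 0 }

theorem appLin_apply (D : CLin L) (x : ℂ) (a : R) : D.appLin x a = D.app x a := rfl

/-- The conformal linear map `c D + e E`. -/
noncomputable def linComb (c e : ℂ) (D E : CLin L) : CLin L where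
  coeff n := c • D.coeff n + e • E.coeff n
  locality a := by
    obtain ⟨N, hN⟩ := D.locality a
    obtain ⟨N', hN'⟩ := E.locality a
    exact ⟨max N N', fun n hn => by
      simp [hN n (le_of_max_le_left hn), hN' n (le_of_max_le_right hn)]⟩
  conf x a := by
    simp only [LinearMap.add_apply, LinearMap.smul_apply]
    rw [finsum_pow_smul_linear_combination (D.locality _) (E.locality _),
      finsum_pow_smul_linear_combination (D.locality _) (E.locality _), D.conf, E.conf]
    simp only [map_add, map_smul]
    module

theorem linComb_app (c e : ℂ) (D E : CLin L) (x : ℂ) (a : R) :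
    (linComb c e D E).app x a = c • D.app x a + e • E.app x a :=
  finsum_pow_smul_linear_combination (D.locality a) (E.locality a) x c e

theorem pow_appLin (D : CLin L) (x y : ℂ) (n : ℕ) (a : R) :
    (((-(x + y)) • (LinearMap.id : R →ₗ[ℂ] R) - L.d) ^ n) (D.appLin x a)
      = D.appLin x ((((-y) • (LinearMap.id : R →ₗ[ℂ] R) - L.d) ^ n) a) := by
  have hd (a : R) : D.appLin x (L.d a) = L.d (D.appLin x a) + x • D.appLin x a := D.conf x a
  induction n generalizing a with
  | zero => simp
  | succ n ih =>
    rw [pow_succ, pow_succ, Module.End.mul_apply, Module.End.mul_apply, ← ih]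
    congr 1
    simp only [LinearMap.sub_apply, LinearMap.smul_apply, LinearMap.id_apply, map_sub, map_smul, hd]
    module

open Polynomial in
/-- By skew-symmetry, the roles of `D` and `D'` in the defining identity of a generalized
conformal derivation can be exchanged. -/
theorem brk_app_add_brk_app_swap {D D' D'' : CLin L}
    (h : ∀ (lam mu : ℂ) (a b : R),
      L.brk (lam + mu) (D.app lam a) b + L.brk mu a (D'.app lam b)
        = D''.app lam (L.brk mu a b)) (lam mu : ℂ) (a b : R) :
    L.brk (lam + mu) (D'.app lam a) b + L.brk mu a (D.app lam b)
      = D''.app lam (L.brk mu a b) := by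
  obtain ⟨N₁, h₁⟩ := L.locality (D.app lam b) a
  obtain ⟨N₂, h₂⟩ := L.locality b (D'.app lam a)
  obtain ⟨N₃, h₃⟩ := L.locality b a
  let T : Module.End ℂ R := (-(lam + mu)) • (LinearMap.id : R →ₗ[ℂ] R) - L.d
  have key := sum_aeval_apply_eq_zero
    ((Finset.range N₁).disjSum ((Finset.range N₂).disjSum (Finset.range N₃)))
    (Sum.elim (fun n => (C lam + X) ^ n) (Sum.elim (fun n => X ^ n) (fun n => X ^ n)))
    (Sum.elim (fun n => L.coeff n (D.app lam b) a) (Sum.elim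
      (fun n => L.coeff n b (D'.app lam a)) (fun n => -D''.appLin lam (L.coeff n b a))))
    (fun x => by
      have hx := h lam x b a
      rw [L.brk_eq_sum_range h₁, L.brk_eq_sum_range h₂, L.brk_eq_sum_range h₃,
        ← appLin_apply D'', map_sum] at hx
      simp only [map_smul] at hx
      simp only [Finset.sum_disjSum, Sum.elim_inl, Sum.elim_inr, eval_pow, eval_add, eval_C,
        eval_X, smul_neg, Finset.sum_neg_distrib]
      rw [← add_assoc, hx, add_neg_cancel]) T
  have hT : algebraMap ℂ (Module.End ℂ R) lam + T
      = (-mu) • (LinearMap.id : R →ₗ[ℂ] R) - L.d := by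
    ext v
    simp only [T, LinearMap.add_apply, Module.algebraMap_end_apply, LinearMap.sub_apply,
      LinearMap.smul_apply, LinearMap.id_apply]
    module
  simp only [Finset.sum_disjSum, Sum.elim_inl, Sum.elim_inr, map_pow, map_add, aeval_C, aeval_X,
    hT, map_neg, Finset.sum_neg_distrib] at key
  simp only [T, pow_appLin] at key
  rw [L.brk_eq_neg_sum_range h₁, L.brk_eq_neg_sum_range h₂, L.brk_eq_neg_sum_range h₃,
    ← appLin_apply D'', map_neg, map_sum, ← sub_eq_zero, ← neg_eq_zero, ← key]
  abel

end CLin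

end

/-- For any Lie conformal algebra `R`, `GDer(R) = QDer(R) + QC(R)`:
every generalized conformal derivation is a sum of a conformal quasiderivation and a
conformal quasicentroid element, and conversely every such sum is a generalized
conformal derivation. -/
theorem stmt8 {R : Type u} [AddCommGroup R] [Module ℂ R] (L : LieConformalAlgebra R) :
    (∀ D : CLin L, IsGDer D → ∃ D₁ D₂ : CLin L, IsQDer D₁ ∧ IsQC D₂ ∧
      ∀ (lam : ℂ) (a : R), D.app lam a = D₁.app lam a + D₂.app lam a) ∧
    (∀ D D₁ D₂ : CLin L, IsQDer D₁ → IsQC D₂ →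
      (∀ (lam : ℂ) (a : R), D.app lam a = D₁.app lam a + D₂.app lam a) → IsGDer D) := by
  constructor
  · rintro D ⟨D', D'', h⟩
    have h' := CLin.brk_app_add_brk_app_swap h
    refine ⟨CLin.linComb (1 / 2) (1 / 2) D D', CLin.linComb (1 / 2) (-(1 / 2)) D D',
      ⟨D'', fun lam mu a b => ?_⟩, fun lam mu a b => ?_, fun lam a => ?_⟩
    · simp only [CLin.linComb_app, L.brk_linear_combination_left, L.brk_linear_combination_right]
      linear_combination (norm := module) (1 / 2 : ℂ) • h lam mu a b + (1 / 2 : ℂ) • h' lam mu a b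
    · simp only [CLin.linComb_app, L.brk_linear_combination_left, L.brk_linear_combination_right]
      linear_combination (norm := module) (1 / 2 : ℂ) • h lam mu a b - (1 / 2 : ℂ) • h' lam mu a b
    · simp only [CLin.linComb_app]
      module
  · rintro D D₁ D₂ ⟨D', h₁⟩ h₂ hD
    refine ⟨CLin.linComb 1 (-1) D₁ D₂, D', fun lam mu a b => ?_⟩
    have hD' : D.app lam a = (1 : ℂ) • D₁.app lam a + (1 : ℂ) • D₂.app lam a := by
      simp only [hD, one_smul]
    rw [hD', CLin.linComb_app, L.brk_linear_combination_left, L.brk_linear_combination_right]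
    linear_combination (norm := module) h₁ lam mu a b + h₂ lam mu a b
end

section
/- For the Virasoro Lie conformal algebra Vir: (i) for every δ ∈ ℂ with δ ≠ 1 and δ ≠ 2, CDer_{(δ,1,1)}(Vir) = 0; (ii) CDer_{(1,1,1)}(Vir) = CInn(Vir); (iii) CDer_{(2,1,1)}(Vir) = { D ∈ gc(Vir) : D_λ(L) = a(λ)L for some a(λ) ∈ ℂ[λ] }. -/
open scoped BigOperators

universe u

section ABC

variable {R : Type u} [AddCommGroup R] [Module ℂ R] {L : LieConformalAlgebra R}

/-- Conformal `(α,β,γ)`-derivations: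
`α • D_λ([a_μ b]) = β • [(D_λ a)_{λ+μ} b] + γ • [a_μ (D_λ b)]`. -/
def IsABCDer (α β γ : ℂ) (D : CLin L) : Prop :=
  ∀ (lam mu : ℂ) (a b : R),
    α • D.app lam (L.brk mu a b)
      = β • L.brk (lam + mu) (D.app lam a) b + γ • L.brk mu a (D.app lam b)

/-- Inner conformal derivations: `D = ad_x` for some `x ∈ R`, i.e. `D_λ(a) = [x_λ a]`. -/
def IsCInn (D : CLin L) : Prop :=
  ∃ x : R, ∀ (lam : ℂ) (a : R), D.app lam a = L.brk lam x a

end ABC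

section Series

variable {R S : Type*} [AddCommGroup R] [Module ℂ R] [AddCommGroup S] [Module ℂ S]

lemma exists_finsum_smul_eq_sum_range {F : ℕ → S} (hF : ∃ N : ℕ, ∀ n : ℕ, N ≤ n → F n = 0) :
    ∃ N : ℕ, ∀ lam : ℂ, ∑ᶠ n : ℕ, lam ^ n • F n = ∑ n ∈ Finset.range N, lam ^ n • F n := by
  obtain ⟨N, hN⟩ := hF
  refine ⟨N, fun lam => finsum_eq_sum_of_support_subset _ fun n hn => ?_⟩
  by_contra h
  simp only [Finset.coe_range, Set.mem_Iio, not_lt] at h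
  exact hn (by simp [hN n h])

lemma finite_support_smul {F : ℕ → S} (hF : ∃ N : ℕ, ∀ n : ℕ, N ≤ n → F n = 0) (lam : ℂ) :
    (Function.support fun n : ℕ => lam ^ n • F n).Finite := by
  obtain ⟨N, hN⟩ := hF
  refine (Set.finite_Iio N).subset fun n hn => ?_
  by_contra h
  exact hn (by simp [hN n (not_lt.mp h)])

/-- The value at `lam` of a locally finite power series of linear maps. -/
noncomputable def seriesEval (F : ℕ → R →ₗ[ℂ] S)
    (hF : ∀ a : R, ∃ N : ℕ, ∀ n : ℕ, N ≤ n → F n a = 0) (lam : ℂ) : R →ₗ[ℂ] S where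
  toFun a := ∑ᶠ n : ℕ, lam ^ n • F n a
  map_add' a b := by
    simp only [map_add, smul_add]
    exact finsum_add_distrib (finite_support_smul (hF a) lam) (finite_support_smul (hF b) lam)
  map_smul' c a := by
    simp only [map_smul, RingHom.id_apply]
    rw [smul_finsum' c (finite_support_smul (hF a) lam)]
    exact finsum_congr fun n => smul_comm _ _ _

/-- A linear functional applied to a finite sum `∑ λ ^ n • F n` is a polynomial in `λ`. -/
lemma exists_polynomial_eval_eq {F : ℕ → S} (hF : ∃ N : ℕ, ∀ n : ℕ, N ≤ n → F n = 0)
    (φ : S →ₗ[ℂ] ℂ) :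
    ∃ g : Polynomial ℂ, ∀ lam : ℂ, g.eval lam = φ (∑ᶠ n : ℕ, lam ^ n • F n) := by
  obtain ⟨N, hN⟩ := exists_finsum_smul_eq_sum_range hF
  refine ⟨∑ n ∈ Finset.range N, Polynomial.C (φ (F n)) * Polynomial.X ^ n, fun lam => ?_⟩
  rw [hN, Polynomial.eval_finsetSum, map_sum]
  exact Finset.sum_congr rfl fun n _ => by simp [mul_comm (lam ^ n)]

end Series

namespace Virasoro

open Polynomial

/-- A linear map intertwining multiplication by `X` and by `g` is determined by its value
at `1`. -/
lemma apply_eq_comp_mul {T : ℂ[X] →ₗ[ℂ] ℂ[X]} {g : ℂ[X]} (hT : ∀ p, T (X * p) = g * T p)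
    (p : ℂ[X]) : T p = p.comp g * T 1 := by
  have hpow (n : ℕ) : T (X ^ n) = g ^ n * T 1 := by
    induction n with
    | zero => simp
    | succ n ih => rw [pow_succ', hT, ih, pow_succ', mul_assoc]
  induction p using Polynomial.induction_on' with
  | add p q hp hq => rw [map_add, hp, hq, add_comp, add_mul]
  | monomial n a =>
    rw [← C_mul_X_pow_eq_monomial, ← smul_eq_C_mul, map_smul, hpow, smul_comp, X_pow_comp,
      smul_mul_assoc]

variable {V : LieConformalAlgebra ℂ[X]}

lemma brk_eq (hd : ∀ p : ℂ[X], V.d p = X * p)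
    (hL : ∀ lam : ℂ, V.brk lam 1 1 = X + C (2 * lam)) (lam : ℂ) (p q : ℂ[X]) :
    V.brk lam p q = C (p.eval (-lam)) * q.comp (X + C lam) * (X + C (2 * lam)) := by
  have hright : V.brk lam p q = q.comp (X + C lam) * V.brk lam p 1 := by
    refine apply_eq_comp_mul
      (T := seriesEval (fun n => V.coeff n p) (fun b => V.locality p b) lam) (fun b => ?_) q
    have h := V.sesq_right lam p b
    rw [hd, hd, smul_eq_C_mul, ← add_mul] at h
    exact h
  have hleft : V.brk lam p 1 = p.comp (C (-lam)) * V.brk lam 1 1 := by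
    refine apply_eq_comp_mul
      (T := seriesEval (fun n => (V.coeff n).flip 1) (fun a => V.locality a 1) lam)
      (fun a => ?_) p
    have h := V.sesq_left lam a 1
    rw [hd, smul_eq_C_mul, ← neg_mul, ← C_neg] at h
    exact h
  rw [hright, hleft, hL, comp_C]
  ring

lemma app_eq (hd : ∀ p : ℂ[X], V.d p = X * p) (D : CLin V) (lam : ℂ) (p : ℂ[X]) :
    D.app lam p = p.comp (X + C lam) * D.app lam 1 := by
  refine apply_eq_comp_mul (T := seriesEval D.coeff D.locality lam) (fun a => ?_) p
  have h := D.conf lam a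
  rw [hd, hd, smul_eq_C_mul, ← add_mul] at h
  exact h

/-- The `(δ,1,1)`-derivation condition only has to be checked on the generator `L`. -/
lemma isABCDer_iff (hd : ∀ p : ℂ[X], V.d p = X * p)
    (hL : ∀ lam : ℂ, V.brk lam 1 1 = X + C (2 * lam)) (δ : ℂ) (D : CLin V) :
    IsABCDer δ 1 1 D ↔ ∀ lam mu : ℂ,
      C δ * ((X + C lam + C (2 * mu)) * D.app lam 1)
        = C ((D.app lam 1).eval (-(lam + mu))) * (X + C (2 * (lam + mu)))
          + (D.app lam 1).comp (X + C mu) * (X + C (2 * mu)) := by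
  constructor
  · intro h lam mu
    have := h lam mu 1 1
    rw [hL, app_eq hd D lam (X + C (2 * mu)), brk_eq hd hL, brk_eq hd hL] at this
    simpa [smul_eq_C_mul] using this
  · intro h lam mu a b
    rw [brk_eq hd hL mu a b, app_eq hd D lam (_ * _), app_eq hd D lam a, app_eq hd D lam b,
      brk_eq hd hL, brk_eq hd hL]
    have hab : (b.comp (X + C lam)).comp (X + C mu) = b.comp (X + C (lam + mu)) := by
      rw [comp_assoc]; congr 1; simp; ring
    have hba : (b.comp (X + C mu)).comp (X + C lam) = b.comp (X + C (lam + mu)) := by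
      rw [comp_assoc]; congr 1; simp; ring
    simp only [mul_comp, C_comp, hba, hab, eval_mul, eval_comp, eval_add, eval_X, eval_C,
      add_comp, X_comp, smul_eq_C_mul, C_mul, C_1, one_mul]
    have hmu : -(lam + mu) + lam = -mu := by ring
    rw [hmu]
    have := h lam mu
    simp only [C_mul] at this
    linear_combination (C (eval (-mu) a) * b.comp (X + C (lam + mu))) * this

/-- The derivation condition on the generator at `μ = 0`. -/
lemma linear_mul_app_one (hd : ∀ p : ℂ[X], V.d p = X * p)
    (hL : ∀ lam : ℂ, V.brk lam 1 1 = X + C (2 * lam)) {δ : ℂ} {D : CLin V}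
    (h : IsABCDer δ 1 1 D) (lam : ℂ) :
    (C (δ - 1) * X + C (δ * lam)) * D.app lam 1
      = C ((D.app lam 1).eval (-lam)) * (X + C (2 * lam)) := by
  have := (isABCDer_iff hd hL δ D).1 h lam 0
  simp only [mul_zero, add_zero, C_0, comp_X] at this
  simp only [C_sub, C_mul, C_1] at this ⊢
  linear_combination this

lemma app_one_eq_C (hd : ∀ p : ℂ[X], V.d p = X * p)
    (hL : ∀ lam : ℂ, V.brk lam 1 1 = X + C (2 * lam)) {δ : ℂ} (hδ : δ ≠ 1) {D : CLin V}
    (h : IsABCDer δ 1 1 D) (lam : ℂ) : D.app lam 1 = C ((D.app lam 1).coeff 0) := by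
  by_cases hf : D.app lam 1 = 0
  · simp [hf]
  have hlin := linear_mul_app_one hd hL h lam
  have hδ' : δ - 1 ≠ 0 := sub_ne_zero.2 hδ
  have hdeg := congrArg natDegree hlin
  have hne : C (δ - 1) * X + C (δ * lam) ≠ 0 := fun h0 => by
    have := natDegree_linear (b := δ * lam) hδ'
    rw [h0, natDegree_zero] at this
    exact zero_ne_one this
  rw [natDegree_mul hne hf, natDegree_linear hδ'] at hdeg
  have hle := (natDegree_C_mul_le ((D.app lam 1).eval (-lam)) (X + C (2 * lam)))
  rw [natDegree_X_add_C] at hle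
  exact eq_C_of_natDegree_eq_zero (by omega)

lemma app_one_eq_zero (hd : ∀ p : ℂ[X], V.d p = X * p)
    (hL : ∀ lam : ℂ, V.brk lam 1 1 = X + C (2 * lam)) {δ : ℂ} (h1 : δ ≠ 1) (h2 : δ ≠ 2)
    {D : CLin V} (h : IsABCDer δ 1 1 D) (lam : ℂ) : D.app lam 1 = 0 := by
  have hc := app_one_eq_C hd hL h1 h lam
  have hlin := linear_mul_app_one hd hL h lam
  rw [hc, eval_C] at hlin
  have := congrArg (coeff · 1) hlin
  simp only [coeff_mul_C, coeff_C_mul, coeff_add, coeff_X_one, coeff_C_succ, add_zero,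
    mul_one] at this
  have h0 : (δ - 2) * (D.app lam 1).coeff 0 = 0 := by linear_combination this
  rw [hc, (mul_eq_zero.1 h0).resolve_left (sub_ne_zero.2 h2), C_0]

lemma exists_app_one_eq (hd : ∀ p : ℂ[X], V.d p = X * p)
    (hL : ∀ lam : ℂ, V.brk lam 1 1 = X + C (2 * lam)) {D : CLin V}
    (h : IsABCDer 1 1 1 D) :
    ∃ c : ℂ[X], ∀ lam : ℂ, D.app lam 1 = C (c.eval lam) * (X + C (2 * lam)) := by
  obtain ⟨c, hc⟩ := exists_polynomial_eval_eq (D.locality 1) (lcoeff ℂ 1)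
  refine ⟨c, fun lam => Polynomial.funext fun x => ?_⟩
  obtain ⟨g, hg⟩ := exists_polynomial_eval_eq (D.locality 1) (leval x)
  have hgc : X * g = X * (c * (C x + C 2 * X)) := by
    refine Polynomial.funext fun t => ?_
    have hlin := linear_mul_app_one hd hL h t
    have hcoeff := congrArg (coeff · 1) hlin
    simp only [sub_self, C_0, zero_mul, zero_add, one_mul, coeff_C_mul, coeff_add, coeff_X_one,
      coeff_C_succ, add_zero, mul_one] at hcoeff
    have heval := congrArg (eval x) hlin
    simp only [sub_self, C_0, zero_mul, zero_add, one_mul, eval_mul, eval_C, eval_add,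
      eval_X] at heval
    have hct : c.eval t = (D.app t 1).coeff 1 := hc t
    have hgt : g.eval t = (D.app t 1).eval x := hg t
    simp only [eval_mul, eval_X, eval_add, eval_C, hct, hgt]
    linear_combination heval - (x + 2 * t) * hcoeff
  have hgt : g.eval lam = (D.app lam 1).eval x := hg lam
  rw [← hgt, mul_left_cancel₀ X_ne_zero hgc]
  simp

end Virasoro

/-- For the Virasoro Lie conformal algebra `Vir = ℂ[∂]L` (modelled on
`Polynomial ℂ` with `∂ = (X * ·)` and `L = 1`, `[L_λ L] = (∂ + 2λ)L`):
(i) `CDer_{(δ,1,1)}(Vir) = 0` for `δ ≠ 1, 2`;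
(ii) `CDer_{(1,1,1)}(Vir) = CInn(Vir)`;
(iii) `CDer_{(2,1,1)}(Vir) = {D : D_λ(L) = a(λ)L, a(λ) ∈ ℂ[λ]}`. -/
theorem stmt19 (V : LieConformalAlgebra (Polynomial ℂ))
    (hd : ∀ p : Polynomial ℂ, V.d p = Polynomial.X * p)
    (hL : ∀ lam : ℂ, V.brk lam 1 1 = Polynomial.X + Polynomial.C (2 * lam)) :
    (∀ δ : ℂ, δ ≠ 1 → δ ≠ 2 →
      {D : CLin V | IsABCDer δ 1 1 D}
        = {D : CLin V | ∀ (lam : ℂ) (a : Polynomial ℂ), D.app lam a = 0}) ∧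
    ({D : CLin V | IsABCDer 1 1 1 D} = {D : CLin V | IsCInn D}) ∧
    ({D : CLin V | IsABCDer 2 1 1 D}
      = {D : CLin V | ∃ a : Polynomial ℂ, ∀ lam : ℂ,
          D.app lam 1 = Polynomial.C (a.eval lam)}) := by
  open Polynomial Virasoro in
  refine ⟨fun δ h1 h2 => ?_, ?_, ?_⟩
  · ext D
    refine ⟨fun h lam a => ?_, fun h => (isABCDer_iff hd hL δ D).2 fun lam mu => ?_⟩
    · rw [app_eq hd, app_one_eq_zero hd hL h1 h2 h, mul_zero]
    · simp [h lam 1]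
  · ext D
    constructor
    · intro h
      obtain ⟨c, hc⟩ := exists_app_one_eq hd hL h
      refine ⟨c.comp (-X), fun lam a => ?_⟩
      rw [app_eq hd, hc, brk_eq hd hL]
      simp only [eval_comp, eval_neg, eval_X, neg_neg]
      ring
    · rintro ⟨p, hp⟩
      refine (isABCDer_iff hd hL 1 D).2 fun lam mu => ?_
      rw [hp, brk_eq hd hL]
      simp only [one_comp, mul_one, eval_mul, eval_C, eval_add, eval_X, mul_comp, C_comp,
        add_comp, X_comp]
      simp only [C_mul, C_add, C_neg, C_1, map_ofNat]
      ring
  · ext D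
    constructor
    · intro h
      obtain ⟨c, hc⟩ := exists_polynomial_eval_eq (D.locality 1) (lcoeff ℂ 0)
      refine ⟨c, fun lam => ?_⟩
      rw [hc]
      exact app_one_eq_C hd hL (by norm_num) h lam
    · rintro ⟨a, ha⟩
      refine (isABCDer_iff hd hL 2 D).2 fun lam mu => ?_
      rw [ha]
      simp only [eval_C, C_comp, C_mul, C_add, map_ofNat]
      ring
end
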